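/- arXiv:1312.1239 — 3 statements merged into one kernel-verified Lean document; each statement's English description precedes it below -/
import Mathlib

section
/- Let A, B, C, D be complex matrices of compatible sizes with A, D square. Set S = A − C D^d B, Z = D − B A^d C, H = B A^d, K = A^d C, and k = ind(A). If A^π C D^d B = 0 and K D^π Z^d H = K D^d Z^π H, then S^d = A^d + K Z^d H + ∑_{i=0}^{k-1} (A^d + K Z^d H)^{i+2} S A^i A^π. -/
open Matrix Finset

attribute [local instance] Classical.propDecidable

noncomputable def drazin {n : Type*} [Fintype n] [DecidableEq n]
    (A : Matrix n n ℂ) : Matrix n n ℂ :=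
  if h : ∃ X : Matrix n n ℂ,
      A * X = X * A ∧ X * A * X = X ∧ ∃ k : ℕ, A ^ (k + 1) * X = A ^ k
  then h.choose else 0

noncomputable def ind {n : Type*} [Fintype n] [DecidableEq n]
    (A : Matrix n n ℂ) : ℕ :=
  sInf {k : ℕ | (A ^ k).rank = (A ^ (k + 1)).rank}

noncomputable def spi {n : Type*} [Fintype n] [DecidableEq n]
    (A : Matrix n n ℂ) : Matrix n n ℂ :=
  1 - A * drazin A

section helpers

def IsDz {R : Type*} [Ring R] (A X : R) : Prop :=
  A * X = X * A ∧ X * A * X = X ∧ ∃ k : ℕ, A ^ (k + 1) * X = A ^ k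

theorem pow_absorb {R : Type*} [Ring R] (A W : R) (hc : A * W = W * A) (k : ℕ)
    (h : A ^ (k + 1) * W = A ^ k) (j : ℕ) : A ^ (k + j) * W ^ j = A ^ k := by
  induction j with
  | zero => simp
  | succ j ih =>
    have : A ^ (k + (j + 1)) * W ^ (j + 1) = A ^ j * (A ^ (k + 1) * W) * W ^ j := by
      rw [show k + (j + 1) = j + (k + 1) by ring, pow_add, pow_succ' W]
      simp only [mul_assoc]
    rw [this, h, ← pow_add, add_comm j k, ih]

theorem isDz_of {R : Type*} [Ring R] (A W : R) (hc : A * W = W * A) (k : ℕ)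
    (h : A ^ (k + 1) * W = A ^ k) : IsDz A (A ^ k * W ^ (k + 1)) := by
  have C : Commute A W := hc
  have e := pow_absorb A W hc k h (k + 1)
  have c1 : Commute A (W ^ (k + 1)) := C.pow_right _
  have c2 : Commute (A ^ (k + 1)) (W ^ (k + 1)) := c1.pow_left _
  refine ⟨?_, ?_, k, ?_⟩
  · have : Commute A (A ^ k * W ^ (k + 1)) := ((Commute.refl A).pow_right k).mul_right c1
    exact this
  · calc A ^ k * W ^ (k + 1) * A * (A ^ k * W ^ (k + 1))
        = A ^ k * (W ^ (k + 1) * (A ^ (k + 1))) * W ^ (k + 1) := by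
          rw [pow_succ' A]; simp only [mul_assoc]
      _ = A ^ (k + (k + 1)) * W ^ (k + 1) * W ^ (k + 1) := by
          rw [← c2.eq, pow_add A k (k + 1)]; simp only [mul_assoc]
      _ = _ := by rw [e]
  · rw [← mul_assoc, ← pow_add, add_comm (k + 1) k, e]

theorem isDz_lift {R : Type*} [Ring R] {A X : R} {k : ℕ} (h : A ^ (k + 1) * X = A ^ k) (l : ℕ) :
    A ^ (l + k + 1) * X = A ^ (l + k) := by
  rw [add_assoc, pow_add, mul_assoc, h, ← pow_add]

theorem isDz_unique {R : Type*} [Ring R] {A X Y : R} (hX : IsDz A X) (hY : IsDz A Y) : X = Y := by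
  obtain ⟨cX, oX, k, hk⟩ := hX
  obtain ⟨cY, oY, l, hl⟩ := hY
  have hk' := isDz_lift hk l
  have hl' := isDz_lift hl k
  rw [add_comm k l] at hl'
  generalize l + k = j at hk' hl'
  have CX : Commute A X := cX
  have CY : Commute A Y := cY
  have hk2 : X * A ^ (j + 1) = A ^ j := by rw [← hk']; exact ((CX.pow_left (j + 1)).eq).symm
  have iX : X * A = X ^ (j + 1) * A ^ (j + 1) := by
    rw [← CX.symm.mul_pow]
    have : IsIdempotentElem (X * A) := by
      unfold IsIdempotentElem; rw [← mul_assoc, oX]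
    exact (this.pow_succ_eq j).symm
  have iY : A * Y = A ^ (j + 1) * Y ^ (j + 1) := by
    rw [← CY.mul_pow]
    have : IsIdempotentElem (A * Y) := by
      unfold IsIdempotentElem; rw [mul_assoc, ← mul_assoc Y, oY]
    exact (this.pow_succ_eq j).symm
  have e1 : X * A = X * A * (A * Y) := by
    calc X * A = X ^ (j + 1) * (A ^ j * A) := by rw [iX, pow_succ A]
      _ = X ^ (j + 1) * A ^ (j + 1) * (Y * A) := by
        conv_lhs => rw [← hl']
        simp only [mul_assoc]
      _ = _ := by rw [← iX, cY]
  have e2 : A * Y = X * A * (A * Y) := by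
    calc A * Y = A * A ^ j * Y ^ (j + 1) := by rw [iY, pow_succ' A]
      _ = A * (X * A ^ (j + 1)) * Y ^ (j + 1) := by rw [hk2]
      _ = A * X * (A ^ (j + 1) * Y ^ (j + 1)) := by simp only [mul_assoc]
      _ = _ := by rw [← iY, cX]
  have e : X * A = A * Y := e1.trans e2.symm
  calc X = X * (A * X) := by rw [← mul_assoc, oX]
    _ = X * A * Y := by rw [cX, e, ← mul_assoc, e]
    _ = Y * A * Y := by rw [e, cY]
    _ = Y := oY

theorem isDz_exists {n : ℕ} (A : Matrix (Fin n) (Fin n) ℂ) : ∃ X, IsDz A X := by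
  obtain ⟨q, hq, hd⟩ := Polynomial.exists_eq_pow_rootMultiplicity_mul_and_not_dvd A.charpoly
    (A.charpoly_monic.ne_zero) 0
  generalize Polynomial.rootMultiplicity 0 A.charpoly = k at hq
  simp only [map_zero, sub_zero] at hq hd
  rw [Polynomial.X_dvd_iff] at hd
  have h0 := Matrix.aeval_self_charpoly A
  rw [hq, ← Polynomial.divX_mul_X_add q] at h0
  simp only [map_mul, map_add, map_pow, Polynomial.aeval_X, Polynomial.aeval_C] at h0
  set r := Polynomial.aeval A q.divX with hr
  have cr : Commute A r := by
    have := Polynomial.aeval_X (R := ℂ) A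
    have h2 : Commute (Polynomial.aeval A (Polynomial.X : Polynomial ℂ)) (Polynomial.aeval A q.divX) :=
      (Commute.all _ _).map (Polynomial.aeval A)
    rwa [this] at h2
  have hW : Commute A (-(q.coeff 0)⁻¹ • r) := cr.smul_right _
  refine ⟨_, isDz_of A (-(q.coeff 0)⁻¹ • r) hW k ?_⟩
  rw [mul_add, Algebra.algebraMap_eq_smul_one, mul_smul_comm, mul_one, ← cr.eq, ← mul_assoc,
    ← pow_succ] at h0
  rw [mul_smul_comm, eq_neg_of_add_eq_zero_left h0, smul_neg, neg_smul, neg_neg, smul_smul,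
    inv_mul_cancel₀ hd, one_smul]

theorem drazin_spec {n : ℕ} (A : Matrix (Fin n) (Fin n) ℂ) : IsDz A (drazin A) := by
  have h : ∃ X : Matrix (Fin n) (Fin n) ℂ,
      A * X = X * A ∧ X * A * X = X ∧ ∃ k : ℕ, A ^ (k + 1) * X = A ^ k := isDz_exists A
  unfold drazin
  rw [dif_pos h]
  exact h.choose_spec

theorem ind_mem {n : ℕ} (A : Matrix (Fin n) (Fin n) ℂ) :
    (A ^ ind A).rank = (A ^ (ind A + 1)).rank := by
  have : {k : ℕ | (A ^ k).rank = (A ^ (k + 1)).rank}.Nonempty := by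
    obtain ⟨X, -, -, k, hk⟩ := isDz_exists A
    refine ⟨k, le_antisymm ?_ ?_⟩
    · conv_lhs => rw [← hk]
      exact Matrix.rank_mul_le_left _ _
    · rw [pow_succ]; exact Matrix.rank_mul_le_left _ _
  exact Nat.sInf_mem this

theorem cancel_pow {n : ℕ} (A : Matrix (Fin n) (Fin n) ℂ) (k : ℕ)
    (h : (A ^ k).rank = (A ^ (k + 1)).rank) :
    ∃ V : Matrix (Fin n) (Fin n) ℂ, A ^ k = A ^ (k + 1) * V := by
  have hr : LinearMap.range (A ^ (k + 1)).mulVecLin = LinearMap.range (A ^ k).mulVecLin := by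
    apply Submodule.eq_of_le_of_finrank_eq
    · rw [pow_succ, Matrix.mulVecLin_mul]; exact LinearMap.range_comp_le_range _ _
    · exact h.symm
  have : ∀ j : Fin n, ∃ v, (A ^ (k + 1)) *ᵥ v = (A ^ k).col j := by
    intro j
    have : (A ^ k) *ᵥ (Pi.single j 1) ∈ LinearMap.range (A ^ (k + 1)).mulVecLin := by
      rw [hr]; exact ⟨_, rfl⟩
    obtain ⟨v, hv⟩ := this
    refine ⟨v, ?_⟩
    rw [Matrix.mulVecLin_apply] at hv
    rw [hv, Matrix.mulVec_single_one]
  choose v hv using this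
  refine ⟨Matrix.of fun i j => v j i, ?_⟩
  ext i j
  have := congrFun (hv j) i
  rw [Matrix.col_apply] at this
  rw [← this, Matrix.mul_apply]
  rfl

theorem pow_ind_spi {n : ℕ} (A : Matrix (Fin n) (Fin n) ℂ) : spi A * A ^ ind A = 0 := by
  obtain ⟨V, hV⟩ := cancel_pow A _ (ind_mem A)
  obtain ⟨c, o, l, hl⟩ := drazin_spec A
  have CA : Commute A (drazin A) := c
  generalize ind A = k at hV
  have hj : ∀ j, A ^ k = A ^ (j + k) * V ^ j := by
    intro j
    induction j with
    | zero => simp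
    | succ j ih =>
      calc A ^ k = A ^ (j + k) * V ^ j := ih
        _ = A ^ j * (A ^ (k + 1) * V) * V ^ j := by rw [← hV, pow_add]
        _ = _ := by
          rw [show j + 1 + k = j + (k + 1) by ring, pow_add A j, pow_succ' V]
          simp only [mul_assoc]
  have cs : Commute (A ^ l) (spi A) := by
    unfold spi
    exact ((Commute.one_right A).sub_right ((Commute.refl A).mul_right CA)).pow_left l
  have z : spi A * A ^ l = 0 := by
    rw [← cs.eq]; unfold spi
    rw [mul_sub, mul_one, ← mul_assoc, ← pow_succ, hl, sub_self]
  rw [hj l, pow_add, ← mul_assoc, ← mul_assoc, z, zero_mul, zero_mul]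

/-- Block-triangular Drazin inverse in a ring. -/
theorem core {R : Type*} [Ring R] (A S P Q X : R) (k : ℕ) (hPQ : P + Q = 1)
    (hQP : Q * P = 0) (cQ : A * Q = Q * A) (hQS : Q * S = Q * A) (hk : Q * A ^ k = 0)
    (hSX : S * X = P) (hXSP : X * S * P = P) (hXP : X * P = X) (hPX : P * X = X) :
    IsDz S (X + ∑ i ∈ range k, X ^ (i + 2) * S * A ^ i * Q) := by
  have CQ : ∀ i, A ^ i * Q = Q * A ^ i := fun i => ((show Commute A Q from cQ).pow_left i).eq
  have hPP : P * P = P := by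
    have : (P + Q) * P = P := by rw [hPQ, one_mul]
    rwa [add_mul, hQP, add_zero] at this
  set Y := X + ∑ i ∈ range k, X ^ (i + 2) * S * A ^ i * Q with hY
  have hQQS : ∀ j, Q * S ^ j = Q * A ^ j := by
    intro j
    induction j with
    | zero => simp
    | succ j ih => rw [pow_succ, ← mul_assoc, ih, ← CQ, mul_assoc, hQS, ← mul_assoc, CQ, pow_succ,
        mul_assoc]
  have hSY : S * Y = P + ∑ i ∈ range k, X ^ (i + 1) * S * A ^ i * Q := by
    rw [hY, mul_add, hSX, mul_sum]
    congr 1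
    apply sum_congr rfl
    intro i _
    have : S * X ^ (i + 2) = X ^ (i + 1) := by
      rw [pow_succ' X (i + 1), ← mul_assoc, hSX, pow_succ', ← mul_assoc, hPX]
    simp only [← mul_assoc]
    rw [this]
  have hXS : X * S = P + X * S * Q := by
    conv_lhs => rw [← mul_one (X * S), ← hPQ, mul_add, hXSP]
  have hYS : Y * S = P + ∑ i ∈ range k, X ^ (i + 1) * S * A ^ i * Q := by
    have e : ∀ i, X ^ (i + 2) * S * A ^ i * Q * S = X ^ (i + 1 + 1) * S * A ^ (i + 1) * Q := by
      intro i
      rw [mul_assoc _ Q S, hQS, ← cQ, ← mul_assoc, mul_assoc _ (A ^ i) A, ← pow_succ]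
    rw [hY, add_mul, sum_mul, sum_congr rfl (fun i _ => e i), hXS, add_assoc]
    congr 1
    have s1 := sum_range_succ' (fun i => X ^ (i + 1) * S * A ^ i * Q) k
    have s2 := sum_range_succ (fun i => X ^ (i + 1) * S * A ^ i * Q) k
    have z : X ^ (k + 1) * S * A ^ k * Q = 0 := by rw [mul_assoc, CQ, hk, mul_zero]
    simp only [z, add_zero] at s2
    rw [← s2, s1]
    simp [add_comm]
  have hYP : Y * P = X := by
    rw [hY, add_mul, hXP, sum_mul, sum_eq_zero, add_zero]
    intro i _
    rw [mul_assoc, hQP, mul_zero]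
  have hPY : P * (S * Y) = S * Y := by
    rw [hSY, mul_add, hPP, mul_sum]
    congr 1
    apply sum_congr rfl
    intro i _
    rw [pow_succ' X]
    simp only [← mul_assoc]
    rw [hPX]
  have hc : S * Y = Y * S := by rw [hSY, hYS]
  refine ⟨hc, ?_, k, ?_⟩
  · calc Y * S * Y = Y * P * (S * Y) := by rw [mul_assoc, mul_assoc, hPY]
      _ = X * (S * Y) := by rw [hYP]
      _ = Y := by
        rw [hSY, mul_add, hXP, hY, mul_sum]
        congr 1
        apply sum_congr rfl
        intro i _
        rw [pow_succ' X (i + 1)]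
        simp only [← mul_assoc]
  · have hTP : S * Y * P = P := by rw [mul_assoc, hYP, hSX]
    have e : (1 - S * Y) * S ^ k = 0 := by
      calc (1 - S * Y) * S ^ k = (1 - S * Y) * ((P + Q) * S ^ k) := by rw [hPQ, one_mul]
        _ = (P - S * Y * P) * S ^ k + (1 - S * Y) * (Q * S ^ k) := by noncomm_ring
        _ = 0 := by rw [hTP, hQQS, hk]; simp
    have CY : Commute S Y := hc
    rw [sub_mul, one_mul, sub_eq_zero] at e
    rw [(CY.pow_left (k + 1)).eq, pow_succ', ← mul_assoc, ← hc]
    exact e.symm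

end helpers

theorem stmt5 {n m : ℕ} (A : Matrix (Fin n) (Fin n) ℂ) (D : Matrix (Fin m) (Fin m) ℂ)
    (C : Matrix (Fin n) (Fin m) ℂ) (B : Matrix (Fin m) (Fin n) ℂ)
    (H : Matrix (Fin m) (Fin n) ℂ) (hH : H = B * drazin A)
    (K : Matrix (Fin n) (Fin m) ℂ) (hK : K = drazin A * C)
    (Z : Matrix (Fin m) (Fin m) ℂ) (hZ : Z = D - B * drazin A * C)
    (S : Matrix (Fin n) (Fin n) ℂ) (hS : S = A - C * drazin D * B)
    (h1 : spi A * (C * drazin D * B) = 0)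
    (h2 : K * spi D * drazin Z * H = K * drazin D * spi Z * H) :
    drazin S = drazin A + K * drazin Z * H +
      ∑ i ∈ range (ind A),
        (drazin A + K * drazin Z * H) ^ (i + 2) * S * A ^ i * spi A := by
  obtain ⟨cA, oA, -⟩ := drazin_spec A
  obtain ⟨cD, -, -⟩ := drazin_spec D
  have hk := pow_ind_spi A
  unfold spi at *
  generalize ind A = k at *
  generalize hDS : drazin S = Sd
  have hSd : IsDz S Sd := hDS ▸ drazin_spec S
  generalize drazin A = a at *
  generalize drazin D = d at *
  generalize drazin Z = z at *
  subst hH hK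
  set P := A * a with hP
  have hPP : P * P = P := by
    rw [hP, mul_assoc, ← mul_assoc a, oA]
  have aP : a * P = a := by rw [hP, ← mul_assoc, oA]
  have Pa : P * a = a := by rw [cA, oA]
  have cP : A * P = P * A := by rw [hP, mul_assoc, ← cA, ← mul_assoc]
  set X := a + a * C * z * (B * a) with hX
  have hPX : P * X = X := by
    rw [hX, mul_add, Pa]; simp only [← Matrix.mul_assoc]; rw [Pa]
  have hXP : X * P = X := by
    rw [hX, add_mul, aP]; simp only [Matrix.mul_assoc]; rw [aP]
  have hPW : P * (C * d * B) = C * d * B := by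
    rw [sub_mul, one_mul, sub_eq_zero] at h1; exact h1.symm
  have hBaC : B * a * C = D - Z := by rw [hZ]; abel
  have hSX : S * X = P := by
    have h3 := congrArg (fun M => A * M) h2
    have key : S * X = P + (A * (a * C * (1 - D * d) * z * (B * a))
        - A * (a * C * d * (1 - Z * z) * (B * a))) := by
      have e1 : S * X = A * a + A * (a * C * z * (B * a)) - P * (C * d * B) * a
          - P * (C * d * B) * (a * C * z * (B * a)) := by
        rw [hPW, hX, hS]; noncomm_ring
      have e2 : P * (C * d * B) * (a * C * z * (B * a))
          = P * (C * d * (B * a * C) * z * (B * a)) := by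
        simp only [Matrix.mul_assoc]
      rw [e1, e2, hBaC, cD, hP]
      simp only [Matrix.mul_sub, Matrix.sub_mul, Matrix.mul_one, Matrix.mul_assoc]
      abel
    rw [key]
    rw [h3, sub_self, add_zero]
  have hQS : (1 - P) * S = (1 - P) * A := by
    rw [hS, mul_sub, h1, sub_zero]
  have hPSP : P * (S * P) = S * P := by
    have : (1 - P) * S * P = 0 := by
      rw [hQS, mul_assoc, cP, ← mul_assoc, sub_mul, one_mul, hPP, sub_self, zero_mul]
    rw [mul_assoc, sub_mul, one_mul, sub_eq_zero] at this
    exact this.symm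
  have hXSP : X * S * P = P := by
    have u : (S * P + (1 - P)) * (X + (1 - P)) = 1 := by
      have : (S * P + (1 - P)) * (X + (1 - P))
          = S * (P * X) + S * (P - P * P) + (X - P * X) + (1 - P - (P - P * P)) := by noncomm_ring
      rw [this, hPX, hSX, hPP]; simp
    have v := mul_eq_one_comm.mp u
    have w := congrArg (fun M => M * P) v
    have : (X + (1 - P)) * (S * P + (1 - P)) * P
        = X * S * (P * P) + X * (P - P * P) + (S * P - P * (S * P)) * P
          + ((P - P * P) - P * (P - P * P)) := by noncomm_ring
    rw [this, hPSP, hPP] at w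
    simpa using w
  exact isDz_unique hSd (core A S P (1 - P) X k (by abel) (by rw [sub_mul, one_mul, hPP, sub_self])
    (by rw [mul_sub, sub_mul, cP, mul_one, one_mul]) hQS hk hSX hXSP hXP hPX)
end

section
/- Let A, B, C, D be complex matrices of compatible sizes with A, D square. Set S = A − C D^d B, Z = D − B A^d C, and k = ind(A). If A^π C D^d B = 0, C D^π Z^d B = 0, and C D^d Z^π B = 0, then S^d = A^d + A^d C Z^d B A^d − ∑_{i=0}^{k-1} (A^d + A^d C Z^d B A^d)^{i+1} A^d C Z^d B A^i A^π + ∑_{i=0}^{k-1} (A^d + A^d C Z^d B A^d)^{i+1} A^d C (Z^d D^π − Z^π D^d) B A^i. -/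
open Matrix Finset

attribute [local instance] Classical.propDecidable

theorem dz_unique {R : Type*} [Ring R] (A X Y : R)
    (hX1 : A * X = X * A) (hX2 : X * A * X = X) (k : ℕ) (hX3 : A ^ (k + 1) * X = A ^ k)
    (hY1 : A * Y = Y * A) (hY2 : Y * A * Y = Y) (l : ℕ) (hY3 : A ^ (l + 1) * Y = A ^ l) :
    X = Y := by
  have key : ∀ X : R, A * X = X * A → X * A * X = X → ∀ j, X ^ (j + 1) * A ^ j = X := by
    intro X h1 h2 j
    induction j with
    | zero => simp
    | succ j ih =>
      calc X ^ (j + 1 + 1) * A ^ (j + 1) = X * (X ^ (j + 1) * A ^ j) * A := by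
            rw [pow_succ' X (j + 1), pow_succ A j]; simp only [mul_assoc]
        _ = X * A * X := by rw [ih, mul_assoc X X A, mul_assoc X A X, h1]
        _ = X := h2
  have up : ∀ (X : R) (k j : ℕ), A ^ (k + 1) * X = A ^ k → A ^ (j + k + 1) * X = A ^ (j + k) := by
    intro X k j h
    rw [add_assoc, pow_add, mul_assoc, h, ← pow_add]
  have hX := up X k l hX3
  have hY := up Y l k hY3
  rw [add_comm k l] at hY
  generalize l + k = K at hX hY
  have cX : Commute A X := hX1
  have cY : Commute A Y := hY1
  have e1 : X = X * A * Y := by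
    calc X = X ^ (K + 1) * A ^ K := (key X hX1 hX2 K).symm
      _ = X ^ (K + 1) * A ^ K * A * Y := by
            conv_lhs => rw [← hY, pow_succ A K]
            simp only [mul_assoc]
      _ = X * A * Y := by rw [key X hX1 hX2 K]
  have e2 : Y = X * A * Y := by
    have kY : A ^ K * Y ^ (K + 1) = Y := by
      rw [(cY.pow_pow K (K + 1)).eq]; exact key Y hY1 hY2 K
    calc Y = A ^ K * Y ^ (K + 1) := kY.symm
      _ = X * A * (A ^ K * Y ^ (K + 1)) := by
          conv_lhs => rw [← hX, (cX.pow_left (K + 1)).eq, pow_succ' A K]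
          simp only [mul_assoc]
      _ = X * A * Y := by rw [kY]
  rw [e1, ← e2]

theorem dz_exists {n : ℕ} (A : Matrix (Fin n) (Fin n) ℂ) :
    ∃ X : Matrix (Fin n) (Fin n) ℂ,
      A * X = X * A ∧ X * A * X = X ∧ ∃ k : ℕ, A ^ (k + 1) * X = A ^ k := by
  obtain ⟨q, hq, hnd⟩ := Polynomial.exists_eq_pow_rootMultiplicity_mul_and_not_dvd A.charpoly
    (A.charpoly_monic.ne_zero) 0
  generalize Polynomial.rootMultiplicity 0 A.charpoly = k at hq
  rw [Polynomial.C_0, sub_zero] at hq hnd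
  have hc : IsCoprime (Polynomial.X ^ (k + 1)) q :=
    ((Polynomial.irreducible_X.coprime_iff_not_dvd).2 hnd).pow_left
  obtain ⟨u, v, huv⟩ := hc
  have h0 : A ^ k * Polynomial.aeval A q = 0 := by
    have := A.aeval_self_charpoly
    rw [hq] at this
    simpa using this
  have h1 := congrArg (Polynomial.aeval A) huv
  simp only [map_add, map_mul, map_pow, Polynomial.aeval_X, map_one] at h1
  have cu : Commute A (Polynomial.aeval A u) := by
    have := Polynomial.aeval_X (R := ℂ) A
    have h := (Commute.all (Polynomial.X : Polynomial ℂ) u).map (Polynomial.aeval A)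
    rwa [this] at h
  have cq : Commute (Polynomial.aeval A v) (Polynomial.aeval A q) :=
    (Commute.all v q).map (Polynomial.aeval A)
  set U := Polynomial.aeval A u
  set V := Polynomial.aeval A v
  set Q := Polynomial.aeval A q
  have h2 : A ^ k * (A ^ (k + 1) * U) = A ^ k := by
    calc A ^ k * (A ^ (k + 1) * U) = A ^ k * (U * A ^ (k + 1) + V * Q) - A ^ k * Q * V := by
          rw [(cu.pow_left (k + 1)).eq, cq.eq]; noncomm_ring
      _ = A ^ k := by rw [h1, h0]; simp
  obtain ⟨w, hw⟩ : ∃ w, w = A ^ k * U := ⟨_, rfl⟩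
  have cw : Commute A w := by
    rw [hw]; exact ((Commute.refl A).pow_right k).mul_right cu
  have h3 : A ^ k * (A * w) = A ^ k := by
    rw [hw, ← mul_assoc A, ← pow_succ', h2]
  have h4 : ∀ j, A ^ k * (A * w) ^ j = A ^ k := by
    intro j
    induction j with
    | zero => simp
    | succ j ih => rw [pow_succ, ← mul_assoc, ih, h3]
  have h5 : A ^ k * (A ^ (k + 1) * w ^ (k + 1)) = A ^ k := by
    rw [← cw.mul_pow, h4]
  have cX : Commute A (A ^ k * w ^ (k + 1)) :=
    ((Commute.refl A).pow_right k).mul_right (cw.pow_right (k + 1))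
  have h6 : A ^ (k + 1) * (A ^ k * w ^ (k + 1)) = A ^ k := by
    rw [← mul_assoc, ← pow_add, add_comm (k + 1) k, pow_add, mul_assoc, h5]
  refine ⟨A ^ k * w ^ (k + 1), cX, ?_, k, h6⟩
  have c2 : Commute (A ^ k) (w ^ (k + 1)) := cw.pow_pow k (k + 1)
  rw [c2.eq, mul_assoc (w ^ (k + 1)), ← pow_succ, ← c2.eq, mul_assoc, h6]
  exact c2.eq.symm

theorem dz_spec {n : ℕ} (A : Matrix (Fin n) (Fin n) ℂ) :
    A * drazin A = drazin A * A ∧ drazin A * A * drazin A = drazin A ∧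
      ∃ k : ℕ, A ^ (k + 1) * drazin A = A ^ k := by
  have h := dz_exists A
  rw [drazin, dif_pos h]
  exact h.choose_spec

theorem dz_eq {n : ℕ} (A X : Matrix (Fin n) (Fin n) ℂ) (h1 : A * X = X * A)
    (h2 : X * A * X = X) (k : ℕ) (h3 : A ^ (k + 1) * X = A ^ k) : drazin A = X := by
  obtain ⟨g1, g2, l, g3⟩ := dz_spec A
  exact dz_unique A _ _ g1 g2 l g3 h1 h2 k h3

theorem ind_spec {n : ℕ} (A : Matrix (Fin n) (Fin n) ℂ) :
    A ^ ind A * (1 - A * drazin A) = 0 := by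
  obtain ⟨g1, g2, l, g3⟩ := dz_spec A
  have hl : A ^ l * (1 - A * drazin A) = 0 := by
    rw [mul_sub, ← mul_assoc, ← pow_succ, g3]; simp
  have hmem : ind A ∈ {k : ℕ | (A ^ k).rank = (A ^ (k + 1)).rank} := by
    apply Nat.sInf_mem
    refine ⟨l, ?_⟩
    apply le_antisymm
    · conv_lhs => rw [← g3]
      exact Matrix.rank_mul_le_left _ _
    · rw [pow_succ]; exact Matrix.rank_mul_le_left _ _
  generalize ind A = k at hmem
  simp only [Set.mem_ofPred_eq] at hmem
  have hr : LinearMap.range (A ^ (k + 1)).mulVecLin = LinearMap.range (A ^ k).mulVecLin := by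
    apply Submodule.eq_of_le_of_finrank_eq
    · rw [pow_succ, Matrix.mulVecLin_mul]
      exact LinearMap.range_comp_le_range _ _
    · exact hmem.symm
  have hY : ∃ Y, A ^ k = A ^ (k + 1) * Y := by
    have : ∀ j : Fin n, ∃ y, (A ^ (k + 1)) *ᵥ y = (A ^ k) *ᵥ (Pi.single j 1) := by
      intro j
      have : (A ^ k).mulVecLin (Pi.single j 1) ∈ LinearMap.range (A ^ (k + 1)).mulVecLin := by
        rw [hr]; exact ⟨_, rfl⟩
      obtain ⟨y, hy⟩ := this
      exact ⟨y, by simpa using hy⟩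
    choose y hy using this
    refine ⟨Matrix.of fun i j => y j i, ?_⟩
    ext i j
    have := congrFun (hy j) i
    simp only [Matrix.mulVec_single_one, Matrix.col_apply] at this
    rw [← this]
    rfl
  obtain ⟨Y, hY⟩ := hY
  have hj : ∀ j, ∃ W, A ^ k = A ^ (j + k) * W := by
    intro j
    induction j with
    | zero => exact ⟨1, by simp⟩
    | succ j ih =>
      obtain ⟨W, hW⟩ := ih
      refine ⟨Y * W, ?_⟩
      calc A ^ k = A ^ j * A ^ k * W := by rw [← pow_add]; exact hW
        _ = A ^ (j + 1 + k) * (Y * W) := by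
          conv_lhs => rw [hY]
          rw [show j + 1 + k = j + (k + 1) by omega, pow_add A j]; simp only [mul_assoc]
  obtain ⟨W, hW⟩ := hj l
  have c : Commute A (1 - A * drazin A) :=
    (Commute.one_right A).sub_right ((Commute.refl A).mul_right g1)
  rw [(c.pow_left k).eq, hW, pow_add, ← mul_assoc, ← mul_assoc, ← (c.pow_left l).eq, hl]
  simp

theorem core_s6 {R : Type*} [Ring R] [IsDedekindFiniteMonoid R] (A a F G X : R) (k : ℕ)
    (h1 : A * a = a * A) (h2 : a * A * a = a) (h3 : A ^ k * (1 - A * a) = 0)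
    (h4 : (1 - A * a) * F = 0) (h5 : F * a * G = G - F) (hX : X = a + a * G * a) :
    ∃ T, T = X - ∑ i ∈ range k, X ^ (i + 1) * (a * G) * A ^ i * (1 - A * a)
        + ∑ i ∈ range k, X ^ (i + 1) * (a * (G - F - G * a * F)) * A ^ i ∧
      (A - F) * T = T * (A - F) ∧ T * (A - F) * T = T ∧ (A - F) ^ (k + 1) * T = (A - F) ^ k := by
  obtain ⟨P, hP⟩ : ∃ P, P = 1 - A * a := ⟨_, rfl⟩
  obtain ⟨E, hE⟩ : ∃ E, E = A * a := ⟨_, rfl⟩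
  rw [← hP] at h3 h4
  have hPE : P = 1 - E := by rw [hP, hE]
  have hEF : E * F = F := by
    rw [hPE, sub_mul, one_mul, sub_eq_zero] at h4; exact h4.symm
  have hEa : E * a = a := by rw [hE, h1, h2]
  have haE : a * E = a := by rw [hE, ← mul_assoc, h2]
  have hEE : E * E = E := by nth_rw 2 [hE]; rw [h1, ← mul_assoc, hEa, hE, h1]
  have cAE : A * E = E * A := by rw [hE, mul_assoc A a A, ← h1]
  have cAP : Commute A P := by
    show A * P = P * A
    rw [hPE, mul_sub, sub_mul, cAE]; simp
  have hPP : P * P = P := by rw [hPE]; simp [mul_sub, sub_mul, hEE]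
  have hPEz : P * E = 0 := by rw [hPE]; simp [sub_mul, hEE]
  have hEP : E * P = 0 := by rw [hPE]; simp [mul_sub, hEE]
  have hEX : E * X = X := by rw [hX, mul_add, ← mul_assoc, ← mul_assoc, hEa]
  have hXE : X * E = X := by rw [hX, add_mul, mul_assoc _ a E, haE]
  have hXP : X * P = 0 := by rw [hPE, mul_sub, hXE]; simp
  have hPX : P * X = 0 := by rw [hPE, sub_mul, hEX]; simp
  have hPS : P * (A - F) = P * A := by rw [mul_sub, h4, sub_zero]
  have hAX : A * X = E + E * G * a := by
    rw [hX, mul_add, ← mul_assoc, ← mul_assoc, ← hE]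
  have hFX : F * X = G * a := by
    rw [hX, mul_add, ← mul_assoc, ← mul_assoc, h5, sub_mul]; abel
  have hEG : E * G = G := by
    have : G = F * a * G + F := by rw [h5]; abel
    rw [this, mul_add, ← mul_assoc, ← mul_assoc, hEF]
  have hSX : (A - F) * X = E := by
    rw [sub_mul, hAX, hFX, hEG]; abel
  obtain ⟨M, hM⟩ : ∃ M, M = (A - F) * E := ⟨_, rfl⟩
  have hMX : M * X = E := by rw [hM, mul_assoc, hEX, hSX]
  have hMP : M * P = 0 := by rw [hM, mul_assoc, hEP, mul_zero]
  have hPM : P * M = 0 := by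
    rw [hM, ← mul_assoc, hPS, ← cAP.eq, mul_assoc, hPEz, mul_zero]
  have hinv : (M + P) * (X + P) = 1 := by
    rw [add_mul, mul_add, mul_add, hMX, hMP, hPX, hPP, hPE]; abel
  have hinv2 := mul_eq_one_symm hinv
  have hXM : X * M = E := by
    rw [add_mul, mul_add, mul_add, hXP, hPM, hPP, add_zero, zero_add, hPE] at hinv2
    have := congrArg (fun t => t - 1 + E) hinv2
    calc X * M = X * M + (1 - E) - 1 + E := by abel
      _ = E := by rw [this]; abel
  have haA : a * A = E := by rw [hE, h1]
  obtain ⟨L, hL⟩ : ∃ L, L = a * (G - F - G * a * F) := ⟨_, rfl⟩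
  have hLX : L = a * G - X * F := by rw [hL, hX]; noncomm_ring
  have hXA : X * A = E + a * G * E := by rw [hX, add_mul, mul_assoc _ a A, haA]
  have hLE : L * E = 0 := by
    have : X * M = E + L * E := by
      rw [hM, hLX, ← mul_assoc, mul_sub, hXA, sub_mul, add_mul, mul_assoc _ E E, hEE, sub_mul]
      abel
    rw [hXM] at this
    exact left_eq_add.mp this
  have hLP : L * P = L := by rw [hPE, mul_sub, hLE]; simp
  obtain ⟨N, hN⟩ : ∃ N, N = -(X * F * P) := ⟨_, rfl⟩
  have hNL : N = L - a * G * P := by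
    rw [hN, ← hLP, hLX, sub_mul]
    abel
  have hEN : E * N = N := by
    rw [hN, mul_neg, ← mul_assoc, ← mul_assoc, hEX]
  obtain ⟨T, hT⟩ : ∃ T, T = ∑ i ∈ range k, X ^ (i + 1) * N * (A ^ i * P) := ⟨_, rfl⟩
  have hform : X + T = X - ∑ i ∈ range k, X ^ (i + 1) * (a * G) * A ^ i * P
        + ∑ i ∈ range k, X ^ (i + 1) * L * A ^ i := by
    rw [sub_add, ← Finset.sum_sub_distrib, sub_eq_add_neg, ← Finset.sum_neg_distrib, hT]
    congr 1
    refine Finset.sum_congr rfl fun i _ => ?_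
    have e : L * A ^ i = L * (A ^ i * P) := by
      rw [(cAP.pow_left i).eq, ← mul_assoc, hLP]
    have e' : P * (A ^ i * P) = A ^ i * P := by
      rw [(cAP.pow_left i).eq, ← mul_assoc, hPP]
    rw [hNL, mul_assoc _ L, e, mul_sub, sub_mul]
    simp only [mul_assoc, e']
    abel
  rw [← hP, ← hL, ← hform]
  obtain ⟨U, hU⟩ : ∃ U, U = ∑ i ∈ range k, X ^ i * N * (A ^ i * P) := ⟨_, rfl⟩
  have hST : (A - F) * T = U := by
    rw [hT, hU, Finset.mul_sum]
    refine Finset.sum_congr rfl fun i _ => ?_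
    have : (A - F) * X ^ (i + 1) * N = X ^ i * N := by
      rw [pow_succ', ← mul_assoc, hSX]
      cases i with
      | zero => simp [hEN]
      | succ i => rw [pow_succ', ← mul_assoc, hEX]
    rw [← this]; simp only [mul_assoc]
  have hXS : X * (A - F) = E + N := by
    have hh : A - F = M + (A - F) * P := by rw [hM, ← mul_add, hPE]; simp
    rw [hh, mul_add, hXM, hN, sub_mul, mul_sub, cAP.eq, ← mul_assoc X P, hXP]
    simp [mul_assoc]
  have hNP : N * P = N := by rw [hN, neg_mul, mul_assoc _ P P, hPP]
  have hTS : T * (A - F) = U - N := by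
    have e1 : T * (A - F) = ∑ i ∈ range k, X ^ (i + 1) * N * (A ^ (i + 1) * P) := by
      rw [hT, Finset.sum_mul]
      refine Finset.sum_congr rfl fun i _ => ?_
      rw [mul_assoc, mul_assoc (A ^ i), hPS, ← cAP.eq, ← mul_assoc (A ^ i), ← pow_succ]
    have e2 := Finset.sum_range_succ (fun i => X ^ i * N * (A ^ i * P)) k
    rw [Finset.sum_range_succ', ← hU, h3, ← e1] at e2
    simp [hNP] at e2
    rw [← e2]; abel
  have hSR : (A - F) * (X + T) = E + U := by rw [mul_add, hSX, hST]
  have hRS : (X + T) * (A - F) = E + U := by rw [add_mul, hXS, hTS]; abel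
  have hET : E * T = T := by
    rw [hT, Finset.mul_sum]
    refine Finset.sum_congr rfl fun i _ => ?_
    rw [pow_succ']; simp only [← mul_assoc]; rw [hEX]
  have hER : E * (X + T) = X + T := by rw [mul_add, hEX, hET]
  have hPR : P * (X + T) = 0 := by rw [hPE, sub_mul, hER]; simp
  have hUP : U * P = U := by
    rw [hU, Finset.sum_mul]
    refine Finset.sum_congr rfl fun i _ => ?_
    simp only [mul_assoc, hPP]
  refine ⟨X + T, rfl, by rw [hSR, hRS], ?_, ?_⟩
  · rw [hRS, add_mul, hER, ← hUP, mul_assoc, hPR]; simp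
  · have cSR : Commute (A - F) (X + T) := by
      show _ * _ = _ * _
      rw [hSR, hRS]
    have hPSk : ∀ j, P * (A - F) ^ j = P * A ^ j := by
      intro j
      induction j with
      | zero => simp
      | succ j ih => rw [pow_succ, ← mul_assoc, ih, ← (cAP.pow_left j).eq, mul_assoc, hPS,
          ← cAP.eq, ← mul_assoc, ← pow_succ, (cAP.pow_left (j + 1)).eq]
    have hW : (P - U) * (A - F) ^ k = 0 := by
      have : P - U = (P - U) * P := by rw [sub_mul, hPP, hUP]
      rw [this, mul_assoc, hPSk, ← (cAP.pow_left k).eq, h3, mul_zero]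
    have h1U : P - U = 1 - (E + U) := by rw [hPE]; abel
    rw [h1U, sub_mul, one_mul, sub_eq_zero, ← hRS, mul_assoc, ← pow_succ'] at hW
    rw [(cSR.pow_left (k + 1)).eq]
    exact hW.symm

theorem stmt6 {n m : ℕ} (A : Matrix (Fin n) (Fin n) ℂ) (D : Matrix (Fin m) (Fin m) ℂ)
    (C : Matrix (Fin n) (Fin m) ℂ) (B : Matrix (Fin m) (Fin n) ℂ)
    (Z : Matrix (Fin m) (Fin m) ℂ) (hZ : Z = D - B * drazin A * C)
    (S : Matrix (Fin n) (Fin n) ℂ) (hS : S = A - C * drazin D * B)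
    (h1 : spi A * (C * drazin D * B) = 0)
    (h2 : C * spi D * drazin Z * B = 0)
    (h3 : C * drazin D * spi Z * B = 0) :
    drazin S = drazin A + drazin A * C * drazin Z * B * drazin A -
      ∑ i ∈ range (ind A),
        (drazin A + drazin A * C * drazin Z * B * drazin A) ^ (i + 1) *
          (drazin A * C * drazin Z * B) * A ^ i * spi A +
      ∑ i ∈ range (ind A),
        (drazin A + drazin A * C * drazin Z * B * drazin A) ^ (i + 1) *
          (drazin A * C * (drazin Z * spi D - spi Z * drazin D) * B) * A ^ i := by
  obtain ⟨a1, a2, -⟩ := dz_spec A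
  obtain ⟨d1, -, -⟩ := dz_spec D
  obtain ⟨z1, -, -⟩ := dz_spec Z
  have hk := ind_spec A
  have hBaC : B * drazin A * C = D - Z := by rw [hZ]; abel
  have e2 : C * drazin Z * B = C * (drazin D * D * drazin Z) * B := by
    rw [spi, d1] at h2
    rw [← sub_eq_zero, ← h2]
    simp only [Matrix.mul_sub, Matrix.sub_mul, Matrix.mul_one, Matrix.one_mul, Matrix.mul_assoc]
  have e3 : C * drazin D * B = C * (drazin D * Z * drazin Z) * B := by
    rw [spi] at h3
    rw [← sub_eq_zero, ← h3]
    simp only [Matrix.mul_sub, Matrix.sub_mul, Matrix.mul_one, Matrix.one_mul, Matrix.mul_assoc]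
  have h5 : (C * drazin D * B) * drazin A * (C * drazin Z * B)
      = C * drazin Z * B - C * drazin D * B := by
    have : (C * drazin D * B) * drazin A * (C * drazin Z * B)
      = C * (drazin D * (B * drazin A * C) * drazin Z) * B := by
      simp only [Matrix.mul_assoc]
    rw [this, hBaC, e2]
    conv_rhs => rw [e3]
    simp only [Matrix.mul_sub, Matrix.sub_mul]
  have h6 : C * (drazin Z * spi D - spi Z * drazin D) * B
      = C * drazin Z * B - C * drazin D * B
        - (C * drazin Z * B) * drazin A * (C * drazin D * B) := by
    have : (C * drazin Z * B) * drazin A * (C * drazin D * B)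
      = C * (drazin Z * (B * drazin A * C) * drazin D) * B := by
      simp only [Matrix.mul_assoc]
    rw [this, hBaC, spi, spi, z1]
    simp only [Matrix.mul_sub, Matrix.sub_mul, Matrix.mul_one, Matrix.one_mul, Matrix.mul_assoc]
    abel
  rw [spi] at h1
  obtain ⟨T, hT, t1, t2, t3⟩ := core_s6 A (drazin A) (C * drazin D * B) (C * drazin Z * B)
    (drazin A + drazin A * (C * drazin Z * B) * drazin A) (ind A) a1 a2 hk h1 h5 rfl
  have hfin := dz_eq S T (by rw [hS, t1]) (by rw [hS, t2]) (ind A) (by rw [hS, t3])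
  rw [hfin, hT, ← h6]
  simp only [spi, Matrix.mul_assoc]
end

section
/- Let A, B, C, D be complex matrices of compatible sizes with A, D square. Set S = A − C D^d B, H = B A^d, K = A^d C, Γ = H K, and k = ind(A). If A^π C D^d B = 0, K Γ^d H S A^d = 0, and K Γ^π D^d H = 0, then S^d = (I − K Γ^d H) A^d (I − K Γ^d H) − ∑_{i=0}^{k-1} ((I − K Γ^d H) A^d)^{i+2} K Γ^d H S A^i − ∑_{i=0}^{k-1} ((I − K Γ^d H) A^d)^{i+1} K Γ^π D^d B A^i. -/
open Matrix Finset

attribute [local instance] Classical.propDecidable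

theorem drz_unique {R : Type*} [Ring R] {A X Y : R} {k l : ℕ}
    (hX1 : A * X = X * A) (hX2 : X * A * X = X) (hX3 : A ^ (k + 1) * X = A ^ k)
    (hY1 : A * Y = Y * A) (hY2 : Y * A * Y = Y) (hY3 : A ^ (l + 1) * Y = A ^ l) : X = Y := by
  have idX : ∀ j : ℕ, X ^ (j + 1) * A ^ (j + 1) = X * A := by
    intro j
    induction j with
    | zero => simp
    | succ j ih =>
      rw [pow_succ' X, pow_succ A, mul_assoc, ← mul_assoc (X ^ (j + 1)), ih]
      rw [← mul_assoc, ← mul_assoc, mul_assoc X X, ← hX1, ← mul_assoc, hX2, hX1]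
  have idY : ∀ j : ℕ, A ^ (j + 1) * Y ^ (j + 1) = A * Y := by
    intro j
    induction j with
    | zero => simp
    | succ j ih =>
      rw [pow_succ' A, pow_succ Y, mul_assoc, ← mul_assoc (A ^ (j + 1)), ih, mul_assoc A Y,
        ← mul_assoc, ← mul_assoc]
      rw [mul_assoc A A Y, hY1, mul_assoc A, hY2, ← hY1]
  have cX : ∀ j : ℕ, A ^ j * X = X * A ^ j := fun j =>
    ((show Commute A X from hX1).pow_left j).eq
  have cY : ∀ j : ℕ, A ^ j * Y = Y * A ^ j := fun j =>
    ((show Commute A Y from hY1).pow_left j).eq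
  have hX3' : A ^ (k + l + 1) * X = A ^ (k + l) := by
    rw [show k + l + 1 = l + (k + 1) by ring, pow_add, mul_assoc, hX3, ← pow_add, add_comm]
  have hY3' : A ^ (k + l + 1) * Y = A ^ (k + l) := by
    rw [show k + l + 1 = k + (l + 1) by ring, pow_add, mul_assoc, hY3, ← pow_add]
  have e1 : X = X * A * Y := by
    calc X = X * A * X := hX2.symm
      _ = X ^ (k + l + 1) * A ^ (k + l + 1) * X := by rw [idX]
      _ = X ^ (k + l + 1) * A ^ (k + l + 1) * Y := by rw [mul_assoc, hX3', mul_assoc, hY3']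
      _ = X * A * Y := by rw [idX]
  have e2 : Y = X * A * Y := by
    calc Y = A * Y * Y := by rw [hY1, hY2]
      _ = Y * (A * Y) := by rw [hY1, mul_assoc, ← hY1, ← mul_assoc]
      _ = Y * (A ^ (k + l + 1) * Y ^ (k + l + 1)) := by rw [idY]
      _ = X * (A ^ (k + l + 1) * Y ^ (k + l + 1)) := by
          rw [← mul_assoc, ← mul_assoc, ← cY, ← cX, hX3', hY3']
      _ = X * A * Y := by rw [idY, mul_assoc]
  rw [e1, ← e2]

theorem drz_exists {n : Type*} [Fintype n] [DecidableEq n] (A : Matrix n n ℂ) :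
    ∃ X : Matrix n n ℂ,
      A * X = X * A ∧ X * A * X = X ∧ ∃ k : ℕ, A ^ (k + 1) * X = A ^ k := by
  obtain ⟨k, y, hc, hy⟩ : ∃ (k : ℕ) (y : Matrix n n ℂ), Commute A y ∧ A ^ (k + 1) * y = A ^ k := by
    have hne : A.charpoly ≠ 0 := (Matrix.charpoly_monic A).ne_zero
    obtain ⟨q, hq, hnd⟩ := Polynomial.exists_eq_pow_rootMultiplicity_mul_and_not_dvd
      A.charpoly hne 0
    set k := A.charpoly.rootMultiplicity 0
    rw [Polynomial.C_0, sub_zero] at hq hnd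
    have hcop : IsCoprime ((Polynomial.X : Polynomial ℂ) ^ (k + 1)) q :=
      (((Polynomial.irreducible_X).coprime_iff_not_dvd).2 hnd).pow_left
    obtain ⟨u, v, huv⟩ := hcop
    have h0 : Polynomial.X ^ (k + 1) * (u * Polynomial.X ^ k) + v * A.charpoly
        = (Polynomial.X : Polynomial ℂ) ^ k := by
      calc _ = (u * Polynomial.X ^ (k + 1) + v * q) * Polynomial.X ^ k := by rw [hq]; ring
        _ = _ := by rw [huv, one_mul]
    refine ⟨k, Polynomial.aeval A (u * Polynomial.X ^ k), ?_, ?_⟩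
    · have := (Commute.all (Polynomial.X : Polynomial ℂ) (u * Polynomial.X ^ k)).map
        (Polynomial.aeval A)
      simpa only [Polynomial.aeval_X] using this
    · have := congrArg (Polynomial.aeval A) h0
      simpa [Matrix.aeval_self_charpoly] using this
  have hj : ∀ j : ℕ, A ^ (k + j) * y ^ j = A ^ k := by
    intro j
    induction j with
    | zero => simp
    | succ j ih =>
      rw [show k + (j + 1) = j + (k + 1) by ring, pow_add, pow_succ' y, mul_assoc,
        ← mul_assoc (A ^ (k + 1)), hy, ← mul_assoc, ← pow_add, add_comm j k, ih]
  have hcp : ∀ i j : ℕ, y ^ i * A ^ j = A ^ j * y ^ i := fun i j => (hc.pow_pow j i).eq.symm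
  refine ⟨A ^ k * y ^ (k + 1), ?_, ?_, k, ?_⟩
  · have : Commute A (A ^ k * y ^ (k + 1)) :=
      ((Commute.refl A).pow_right k).mul_right (hc.pow_right _)
    exact this.eq
  · calc A ^ k * y ^ (k + 1) * A * (A ^ k * y ^ (k + 1))
        = A ^ k * (y ^ (k + 1) * A ^ (k + 1)) * y ^ (k + 1) := by
          rw [pow_succ' A]; simp only [mul_assoc]
      _ = A ^ (k + (k + 1)) * y ^ (k + 1) * y ^ (k + 1) := by
          rw [hcp, pow_add A k (k+1)]; simp only [mul_assoc]
      _ = _ := by rw [hj]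
  · rw [← mul_assoc, ← pow_add, add_comm (k + 1) k, hj]

theorem drz_spec {n : Type*} [Fintype n] [DecidableEq n] (A : Matrix n n ℂ) :
    A * drazin A = drazin A * A ∧ drazin A * A * drazin A = drazin A ∧
      ∃ k : ℕ, A ^ (k + 1) * drazin A = A ^ k := by
  have h := drz_exists A
  unfold drazin
  rw [dif_pos h]
  exact h.choose_spec

theorem drz_eq {n : Type*} [Fintype n] [DecidableEq n] (A X : Matrix n n ℂ)
    (h1 : A * X = X * A) (h2 : X * A * X = X) (k : ℕ) (h3 : A ^ (k + 1) * X = A ^ k) :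
    drazin A = X := by
  obtain ⟨g1, g2, l, g3⟩ := drz_spec A
  exact drz_unique g1 g2 g3 h1 h2 h3

theorem drz_ind {n : Type*} [Fintype n] [DecidableEq n] (A : Matrix n n ℂ) :
    (1 - A * drazin A) * A ^ (ind A) = 0 := by
  obtain ⟨g1, g2, l, g3⟩ := drz_spec A
  have hmem : ind A ∈ {k : ℕ | (A ^ k).rank = (A ^ (k + 1)).rank} := by
    apply Nat.sInf_mem
    refine ⟨l, le_antisymm ?_ ?_⟩
    · conv_lhs => rw [← g3]
      exact Matrix.rank_mul_le_left _ _
    · rw [pow_succ]; exact Matrix.rank_mul_le_left _ _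
  set k := ind A
  have hr : (A ^ k).rank = (A ^ (k + 1)).rank := hmem
  have hle : LinearMap.range (A ^ (k + 1)).mulVecLin ≤ LinearMap.range (A ^ k).mulVecLin := by
    rw [pow_succ, Matrix.mulVecLin_mul]
    exact LinearMap.range_comp_le_range _ _
  have heq := Submodule.eq_of_le_of_finrank_eq hle hr.symm
  have hex : ∀ j : n, ∃ w : n → ℂ, (A ^ (k + 1)) *ᵥ w = (A ^ k) *ᵥ (Pi.single j 1) := by
    intro j
    have : (A ^ k).mulVecLin (Pi.single j 1) ∈ LinearMap.range (A ^ (k + 1)).mulVecLin := by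
      rw [heq]; exact LinearMap.mem_range_self _ _
    exact this
  choose w hw using hex
  obtain ⟨W, hW⟩ : ∃ W : Matrix n n ℂ, A ^ (k + 1) * W = A ^ k := by
    refine ⟨fun i j => w j i, ?_⟩
    ext i j
    have := congrFun (hw j) i
    rw [Matrix.mulVec_single_one] at this
    exact this
  have hj : ∀ j : ℕ, A ^ (k + j) * W ^ j = A ^ k := by
    intro j
    induction j with
    | zero => simp
    | succ j ih =>
      rw [show k + (j + 1) = j + (k + 1) by ring, pow_add, pow_succ' W, mul_assoc,
        ← mul_assoc (A ^ (k + 1)), hW, ← mul_assoc, ← pow_add, add_comm j k, ih]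
  have hl : (1 - A * drazin A) * A ^ l = 0 := by
    have : A * drazin A * A ^ l = A ^ l := by
      rw [g1, mul_assoc, ← pow_succ', ← ((show Commute A (drazin A) from g1).pow_left (l+1)).eq, g3]
    rw [sub_mul, this, one_mul, sub_self]
  rw [← hj l, add_comm k l, pow_add, mul_assoc, ← mul_assoc, hl, zero_mul]


theorem key_drz {R : Type*} [Ring R] (hDF : ∀ x y : R, x * y = 1 → y * x = 1)
    (A a P X S T e f Z : R) (k : ℕ)
    (he : e = A * a) (hc : A * a = a * A) (ha : a * A * a = a)
    (hk : (1 - e) * A ^ k = 0) (hPe : P * e = P) (heP : e * P = P) (hPP : P * P = P)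
    (hX : e * X = X) (hS : S = A - X) (hPS : P * S * a = 0)
    (h3 : (1 - P) * a * X * a = 0) (hT : T = (1 - P) * a * (1 - P)) (hf : f = e - P)
    (hZ : Z = T - ∑ i ∈ range k, T ^ (i + 2) * (X * (1 - e)) * A ^ i) :
    S * Z = Z * S ∧ Z * S * Z = Z ∧ S ^ (k + 2) * Z = S ^ (k + 1) := by
  have hee : e * e = e := by
    rw [he, mul_assoc, ← mul_assoc a, ha]
  have hea : e * a = a := by rw [he, hc, ha]
  have hae : a * e = a := by rw [he, ← mul_assoc, ha]
  have heA : e * A = A * e := by rw [he, mul_assoc, ← hc]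
  have heT : e * T = T := by
    rw [hT, ← mul_assoc, ← mul_assoc, mul_sub e 1 P, mul_one, heP, sub_mul, hea, sub_mul 1 P a, one_mul]
  have hTe : T * e = T := by
    rw [hT, mul_assoc, sub_mul (1 : R) P e, hPe, one_mul, mul_assoc (1 - P), mul_sub, hae,
      mul_assoc, mul_sub a, mul_one]
  have hPT : P * T = 0 := by
    rw [hT, ← mul_assoc, ← mul_assoc, mul_sub P 1 P, mul_one, hPP, sub_self, zero_mul, zero_mul]
  have hTP : T * P = 0 := by
    rw [hT, mul_assoc, sub_mul (1 : R) P P, hPP, one_mul, sub_self, mul_zero]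
  have hfT : f * T = T := by rw [hf, sub_mul, heT, hPT, sub_zero]
  have hTf : T * f = T := by rw [hf, mul_sub, hTe, hTP, sub_zero]
  have hff : f * f = f := by
    rw [hf, sub_mul, mul_sub, mul_sub, hee, heP, hPe, hPP]; abel
  have hfe : f * e = f := by rw [hf, sub_mul, hee, hPe]
  have hef : e * f = f := by rw [hf, mul_sub, hee, heP]
  have hpA : ∀ i, e * A ^ i = A ^ i * e := fun i => ((show Commute e A from heA).pow_right i).eq
  have hae' : a * A = e := by rw [he, hc]
  have hPSe : P * S * e = 0 := by rw [← hae', ← mul_assoc, hPS, zero_mul]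
  have h3e : (1 - P) * a * X * e = 0 := by rw [← hae', ← mul_assoc, h3, zero_mul]
  have heSe : e * (S * e) = S * e := by
    rw [hS, sub_mul, mul_sub, ← mul_assoc e X, hX, ← mul_assoc e A, heA, mul_assoc, hee]
  have hTSe : T * (S * e) = f := by
    have h1 : T * (S * e) = (1 - P) * a * (S * e) := by
      rw [hT, mul_assoc, sub_mul (1 : R) P (S * e), ← mul_assoc P, hPSe, sub_zero, one_mul]
    rw [h1, hS, sub_mul A, mul_sub, ← mul_assoc _ X e, h3e, sub_zero, ← heA, mul_assoc, ← mul_assoc a,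
      hae, hae', sub_mul, one_mul, hPe, hf]
  have hfSe : f * (S * e) = S * e := by
    rw [hf, sub_mul, heSe, ← mul_assoc P, hPSe, sub_zero]
  have hST : S * T = f := by
    have h1 : (T + (1 - f)) * (S * e * f + (1 - f)) = 1 := by
      have e1 : T * (S * e * f) = f := by rw [← mul_assoc, hTSe, hff]
      have e2 : (1 - f) * (S * e * f) = 0 := by
        rw [← mul_assoc, sub_mul 1 f (S * e), hfSe, one_mul, sub_self, zero_mul]
      have e3 : T * (1 - f) = 0 := by rw [mul_sub, hTf, mul_one, sub_self]
      have e4 : (1 - f) * (1 - f) = 1 - f := by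
        rw [sub_mul, mul_sub, mul_sub, hff]; simp
      rw [add_mul, mul_add, mul_add, e1, e2, e3, e4]; abel
    have h2 := hDF _ _ h1
    have e1 : S * e * f * T = S * T := by rw [mul_assoc, hfT, mul_assoc, heT]
    have e2 : S * e * f * (1 - f) = 0 := by rw [mul_assoc, mul_sub, hff]; simp
    have e3 : (1 - f) * T = 0 := by rw [sub_mul, hfT]; simp
    have e4 : (1 - f) * (1 - f) = 1 - f := by
      rw [sub_mul, mul_sub, mul_sub, hff]; simp
    rw [add_mul, mul_add, mul_add, e1, e2, e3, e4] at h2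
    have h5 : S * T - f = 0 := by
      calc S * T - f = (S * T + 0 + (0 + (1 - f))) - 1 := by abel
        _ = 0 := by rw [h2, sub_self]
    exact sub_eq_zero.1 h5
  have hgS : (1 - e) * S = (1 - e) * A := by
    rw [hS, mul_sub, sub_mul 1 e X, hX, one_mul, sub_self, sub_zero]
  have hgA : ∀ i, (1 - e) * A ^ i = A ^ i * (1 - e) := by
    intro i; rw [sub_mul, mul_sub, hpA, one_mul, mul_one]
  have hge : (1 - e) * e = 0 := by rw [sub_mul, hee, one_mul, sub_self]
  have hgg : (1 - e) * (1 - e) = 1 - e := by rw [mul_sub, hge, mul_one, sub_zero]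
  have hgAS : ∀ i, (1 - e) * A ^ i * S = (1 - e) * A ^ (i + 1) := by
    intro i
    rw [hgA, mul_assoc, hgS, ← mul_assoc, ← hgA, mul_assoc, pow_succ]
  have hTx : T * S = f - T * (X * (1 - e)) := by
    have : S = S * e + (A * (1 - e) - X * (1 - e)) := by rw [← sub_mul, ← hS]; noncomm_ring
    have hTA : T * (A * (1 - e)) = 0 := by
      have := hgA 1
      rw [pow_one] at this
      rw [← this, ← hTe, mul_assoc, ← mul_assoc e, mul_sub e, hee]; simp
    conv_lhs => rw [this]
    rw [mul_add, hTSe, mul_sub, hTA]; abel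
  have hSZ : S * Z = f - ∑ i ∈ range k, T ^ (i + 1) * (X * (1 - e)) * A ^ i := by
    rw [hZ, mul_sub, hST, mul_sum]
    congr 1
    refine sum_congr rfl fun i _ => ?_
    rw [← mul_assoc, ← mul_assoc, pow_succ' T (i + 1), ← mul_assoc S, hST, pow_succ' T i,
      ← mul_assoc f, hfT]
  have hZS : Z * S = f - ∑ i ∈ range k, T ^ (i + 1) * (X * (1 - e)) * A ^ i := by
    have hlast : T ^ (k + 1) * (X * (1 - e)) * A ^ k = 0 := by
      rw [mul_assoc, mul_assoc, hk, mul_zero, mul_zero]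
    have : ∑ i ∈ range k, T ^ (i + 1) * (X * (1 - e)) * A ^ i
        = ∑ i ∈ range (k + 1), T ^ (i + 1) * (X * (1 - e)) * A ^ i := by
      rw [sum_range_succ, hlast, add_zero]
    rw [this, sum_range_succ', hZ, sub_mul, hTx, sum_mul]
    have : ∀ i ∈ range k, T ^ (i + 2) * (X * (1 - e)) * A ^ i * S
        = T ^ (i + 1 + 1) * (X * (1 - e)) * A ^ (i + 1) := by
      intro i _
      simp only [mul_assoc]
      rw [← mul_assoc _ _ S, hgAS]
    rw [sum_congr rfl this]
    simp only [zero_add, pow_one, pow_zero, mul_one]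
    abel
  have heZ : e * Z = Z := by
    rw [hZ, mul_sub, heT, mul_sum]
    congr 1
    refine sum_congr rfl fun i _ => ?_
    rw [pow_succ' T (i + 1)]
    simp only [← mul_assoc]
    rw [heT]
  have hfZ : f * Z = Z := by
    rw [hZ, mul_sub, hfT, mul_sum]
    congr 1
    refine sum_congr rfl fun i _ => ?_
    rw [pow_succ' T (i + 1)]
    simp only [← mul_assoc]
    rw [hfT]
  have hgAe : ∀ i, (1 - e) * (A ^ i * e) = 0 := by
    intro i
    rw [← mul_assoc, hgA, mul_assoc, hge, mul_zero]
  have hsum : ∀ Y, e * Y = Y →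
      (∑ i ∈ range k, T ^ (i + 1) * (X * (1 - e)) * A ^ i) * Y = 0 := by
    intro Y hY
    rw [sum_mul]
    refine sum_eq_zero fun i _ => ?_
    rw [← hY]
    simp only [mul_assoc]
    rw [← mul_assoc (A ^ i) e Y, ← mul_assoc (1 - e), hgAe]
    simp
  have hcomm : S * Z = Z * S := by rw [hSZ, hZS]
  refine ⟨hcomm, ?_, ?_⟩
  · rw [hZS, sub_mul, hfZ, hsum Z heZ, sub_zero]
  · have hE : (1 - Z * S) * (S * e) = 0 := by
      rw [sub_mul, hZS, sub_mul, hfSe, hsum _ heSe]; simp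
    have hES : (1 - Z * S) * S = (1 - Z * S) * S * (1 - e) := by
      rw [mul_sub, mul_one, mul_assoc _ S e, hE, sub_zero]
    have hgSj : ∀ j, (1 - e) * S ^ j = (1 - e) * A ^ j := by
      intro j
      induction j with
      | zero => simp
      | succ j ih => rw [pow_succ, ← mul_assoc, ih, hgAS]
    have hfin : (1 - Z * S) * S ^ (k + 1) = 0 := by
      rw [pow_succ', ← mul_assoc, hES, mul_assoc, hgSj, hk, mul_zero]
    rw [sub_mul, one_mul, sub_eq_zero] at hfin
    have hcp := ((show Commute S Z from hcomm).pow_left (k + 2)).eq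
    rw [hcp]
    rw [mul_assoc, ← pow_succ'] at hfin
    exact hfin.symm

theorem key_rhs {R : Type*} [Ring R] 
    (A a P X S T e : R) (k : ℕ)
    (he : e = a * A) 
    (hPP : P * P = P) (hS : S = A - X) (hPS : P * S * a = 0) (hPA : P * (A * (1 - e)) = 0)
    (h3 : (1 - P) * a * X * a = 0) (hT : T = (1 - P) * a * (1 - P)) :
    T - ∑ i ∈ range k, ((1 - P) * a) ^ (i + 2) * (P * S) * A ^ i
      - ∑ i ∈ range k, ((1 - P) * a) ^ (i + 1) * ((1 - P) * a * X) * A ^ i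
    = T - ∑ i ∈ range k, T ^ (i + 2) * (X * (1 - e)) * A ^ i := by
  rw [sub_sub, ← sum_add_distrib]
  congr 1
  refine sum_congr rfl fun i _ => ?_
  set r := (1 - P) * a with hr
  have hQr : (1 - P) * r = r := by
    rw [hr, ← mul_assoc]
    congr 1
    rw [sub_mul, mul_sub, mul_sub, hPP]; simp
  have hpow : ∀ j : ℕ, T ^ (j + 1) = r ^ (j + 1) * (1 - P) := by
    intro j
    induction j with
    | zero => simp [hT]
    | succ j ih =>
      rw [pow_succ T, ih, hT, mul_assoc, ← mul_assoc (1 - P) r, hQr, ← mul_assoc, ← pow_succ]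
  have hPSe : P * S * e = 0 := by rw [he, ← mul_assoc, hPS, zero_mul]
  have h3e : r * X * e = 0 := by rw [he, ← mul_assoc, h3, zero_mul]
  have hPSg : P * S = - (P * (X * (1 - e))) := by
    have : P * S = P * S * e + (P * (A * (1 - e)) - P * (X * (1 - e))) := by
      rw [hS]; noncomm_ring
    rw [this, hPSe, hPA]; abel
  have hrX : r * X = r * (X * (1 - e)) := by
    rw [← mul_assoc, mul_sub, h3e]; simp
  rw [hpow, hPSg, hrX, ← mul_assoc (r ^ (i + 1)) r, ← pow_succ]
  noncomm_ring

theorem stmt12 {n m : ℕ} (A : Matrix (Fin n) (Fin n) ℂ) (D : Matrix (Fin m) (Fin m) ℂ)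
    (C : Matrix (Fin n) (Fin m) ℂ) (B : Matrix (Fin m) (Fin n) ℂ)
    (H : Matrix (Fin m) (Fin n) ℂ) (hH : H = B * drazin A)
    (K : Matrix (Fin n) (Fin m) ℂ) (hK : K = drazin A * C)
    (G : Matrix (Fin m) (Fin m) ℂ) (hG : G = H * K)
    (S : Matrix (Fin n) (Fin n) ℂ) (hS : S = A - C * drazin D * B)
    (h1 : spi A * (C * drazin D * B) = 0)
    (h2 : K * drazin G * H * S * drazin A = 0)
    (h3 : K * spi G * drazin D * H = 0) :
    drazin S = (1 - K * drazin G * H) * drazin A * (1 - K * drazin G * H) -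
      ∑ i ∈ range (ind A),
        ((1 - K * drazin G * H) * drazin A) ^ (i + 2) * (K * drazin G * H * S) * A ^ i -
      ∑ i ∈ range (ind A),
        ((1 - K * drazin G * H) * drazin A) ^ (i + 1) * (K * spi G * drazin D * B) * A ^ i := by
  obtain ⟨a1, a2, -⟩ := drz_spec A
  obtain ⟨g1, g2, -⟩ := drz_spec G
  have a3 := drz_ind A
  unfold spi at *
  set a := drazin A with ha
  set g := drazin G with hg
  set d := drazin D with hd
  set P := K * g * H with hP
  have hPP : P * P = P := by
    have : P * P = K * (g * (H * K) * g) * H := by rw [hP]; simp only [Matrix.mul_assoc]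
    rw [this, ← hG, g2]
  have heK : A * a * K = K := by
    rw [hK, ← Matrix.mul_assoc, a1, a2]
  have hHe : H * (A * a) = H := by
    rw [hH, Matrix.mul_assoc, ← Matrix.mul_assoc a, a2]
  have hPe : P * (A * a) = P := by
    rw [hP, Matrix.mul_assoc, hHe]
  have heP : A * a * P = P := by
    rw [hP, Matrix.mul_assoc K, ← Matrix.mul_assoc (A * a), heK]
  have hX : A * a * (C * d * B) = C * d * B := by
    rw [Matrix.sub_mul, Matrix.one_mul, sub_eq_zero] at h1
    exact h1.symm
  have hKs : K * (1 - G * g) = (1 - P) * K := by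
    rw [g1, hG, Matrix.mul_sub, Matrix.sub_mul, Matrix.mul_one, Matrix.one_mul, hP]
    simp only [Matrix.mul_assoc]
  have hW : K * (1 - G * g) * d * B = (1 - P) * a * (C * d * B) := by
    rw [hKs, hK]; simp only [Matrix.mul_assoc]
  have h3' : (1 - P) * a * (C * d * B) * a = 0 := by
    rw [← hW, Matrix.mul_assoc, ← hH, h3]
  have hPA : P * (A * (1 - a * A)) = 0 := by
    have : A * (1 - a * A) = (1 - A * a) * A := by noncomm_ring
    rw [this, ← Matrix.mul_assoc, Matrix.mul_sub, hPe, Matrix.mul_one, sub_self, Matrix.zero_mul]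
  rw [hW]
  have e1 := key_rhs A a P (C * d * B) S _ (a * A) (ind A) rfl hPP hS h2 hPA h3' rfl
  rw [e1]
  obtain ⟨k1, k2, k3⟩ := key_drz (fun x y h => mul_eq_one_comm.1 h) A a P (C * d * B) S _
    (A * a) _ _ (ind A) rfl a1 a2 a3 hPe heP hPP hX hS h2 h3' rfl rfl rfl
  rw [← a1]
  exact drz_eq S _ k1 k2 _ k3
end
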